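/- arXiv:1911.06458 — 4 statements merged into one kernel-verified Lean document; each statement's English description precedes it below -/
import Mathlib

section
/- Let A = [a_{ij}] ∈ ℝ^{N×N} be the adjacency matrix of a weighted directed graph (a_{ij} ≥ 0, a_{ii} = 0) and let L = D_in − A be its Laplacian, where D_in = diag(d_in^1,…,d_in^N) and d_in^i = Σ_{j=1}^N a_{ij}. Then the graph is weight-balanced (i.e. Σ_{j=1}^N a_{ij} = Σ_{j=1}^N a_{ji} for every i) if and only if the symmetric matrix L + Lᵀ is positive semidefinite. -/
open Matrix

/-- The Laplacian `L = D_in − A` of a weighted directed graph with adjacency matrix `A`. -/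
noncomputable def graphLaplacian {N : ℕ} (A : Matrix (Fin N) (Fin N) ℝ) :
    Matrix (Fin N) (Fin N) ℝ :=
  Matrix.of fun i j => (if i = j then ∑ k, A i k else 0) - A i j

/-- The Laplacian acts on a vector by weighted differences. -/
theorem graphLaplacian_mulVec {N : ℕ} (A : Matrix (Fin N) (Fin N) ℝ) (x : Fin N → ℝ)
    (i : Fin N) : (graphLaplacian A *ᵥ x) i = ∑ j, A i j * (x i - x j) := by
  simp [graphLaplacian, mulVec, dotProduct, sub_mul, mul_sub, Finset.sum_sub_distrib,
    Finset.sum_mul]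

theorem graphLaplacian_transpose_mulVec_one {N : ℕ} (A : Matrix (Fin N) (Fin N) ℝ)
    (i : Fin N) : ((graphLaplacian A)ᵀ *ᵥ 1) i = ∑ j, A i j - ∑ j, A j i := by
  simp [graphLaplacian, mulVec, dotProduct, Finset.sum_sub_distrib]

theorem dotProduct_add_transpose_mulVec {n : Type*} [Fintype n] (M : Matrix n n ℝ)
    (x : n → ℝ) : x ⬝ᵥ ((M + Mᵀ) *ᵥ x) = 2 * (x ⬝ᵥ (M *ᵥ x)) := by
  rw [add_mulVec, dotProduct_add, mulVec_transpose, dotProduct_comm x (x ᵥ* M),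
    ← dotProduct_mulVec, two_mul]

/-- The quadratic form of `L + Lᵀ` is the weighted sum of squared differences, corrected by
the imbalance between in-degrees and out-degrees. -/
theorem dotProduct_graphLaplacian_add_transpose_mulVec {N : ℕ}
    (A : Matrix (Fin N) (Fin N) ℝ) (x : Fin N → ℝ) :
    x ⬝ᵥ ((graphLaplacian A + (graphLaplacian A)ᵀ) *ᵥ x) =
      ∑ i, ∑ j, A i j * (x i - x j) ^ 2 + ∑ i, (∑ j, A i j - ∑ j, A j i) * x i ^ 2 := by
  have hswap : ∑ i, ∑ j, A j i * x i ^ 2 = ∑ i, ∑ j, A i j * x j ^ 2 := Finset.sum_comm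
  rw [dotProduct_add_transpose_mulVec]
  simp only [dotProduct, graphLaplacian_mulVec, sub_mul,
    Finset.sum_mul, Finset.sum_sub_distrib, hswap]
  simp only [Finset.mul_sum, ← Finset.sum_sub_distrib, ← Finset.sum_add_distrib]
  exact Finset.sum_congr rfl fun i _ => Finset.sum_congr rfl fun j _ => by ring

/-- A weighted directed graph (adjacency matrix `A` with nonnegative weights and zero
diagonal) is weight-balanced, i.e. every weighted in-degree equals the corresponding
weighted out-degree, if and only if `L + Lᵀ` is positive semidefinite, where
`L = D_in − A` is the Laplacian. -/
theorem weight_balanced_iff_posSemidef {N : ℕ} (A : Matrix (Fin N) (Fin N) ℝ)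
    (hA_nonneg : ∀ i j, 0 ≤ A i j) (hA_diag : ∀ i, A i i = 0) :
    (∀ i, ∑ j, A i j = ∑ j, A j i) ↔
      (graphLaplacian A + (graphLaplacian A)ᵀ).PosSemidef := by
  constructor
  · intro hbal
    refine .of_dotProduct_mulVec_nonneg ?_ fun x => ?_
    · simp [IsHermitian, add_comm]
    · rw [star_trivial, dotProduct_graphLaplacian_add_transpose_mulVec]
      simp only [hbal, sub_self, zero_mul, Finset.sum_const_zero, add_zero]
      exact Finset.sum_nonneg fun i _ => Finset.sum_nonneg fun j _ =>
        mul_nonneg (hA_nonneg i j) (sq_nonneg _)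
  · intro hpsd i
    have hL : graphLaplacian A *ᵥ 1 = 0 := by
      ext k
      simp [graphLaplacian_mulVec]
    have hker := (hpsd.dotProduct_mulVec_zero_iff 1).1 (by
      rw [star_trivial, dotProduct_add_transpose_mulVec, hL, dotProduct_zero, mul_zero])
    rw [add_mulVec, hL, zero_add] at hker
    have hi := congrFun hker i
    rw [graphLaplacian_transpose_mulVec_one] at hi
    exact sub_eq_zero.1 hi
end

section
/- Let Ω ⊆ ℝ^n be nonempty, closed and convex with metric projection P_Ω, and let F : ℝ^n → ℝ^n be μ-strongly monotone and κ-Lipschitz continuous on Ω (μ, κ > 0). Let 0 < α < 2μ/κ², and define H(x) = x − P_Ω(x − α F(x)). Then H is ω₁-strongly monotone on Ω with ω₁ = (2αμ − α²κ²)/(2 + ακ); that is, ⟨x − y, H(x) − H(y)⟩ ≥ ω₁‖x − y‖² for all x, y ∈ Ω. -/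
open scoped RealInnerProductSpace

section MetricProjection

variable {E : Type*} [NormedAddCommGroup E] [InnerProductSpace ℝ E] {Ω : Set E}

/-- The variational inequality characterizing a nearest point of a convex set. -/
lemma inner_sub_nearest_nonpos (hconv : Convex ℝ Ω) {z p : E} (hp : p ∈ Ω)
    (hmin : ∀ w ∈ Ω, ‖z - p‖ ≤ ‖z - w‖) : ∀ w ∈ Ω, ⟪z - p, w - p⟫ ≤ 0 := by
  have : Nonempty Ω := ⟨⟨p, hp⟩⟩
  refine (norm_eq_iInf_iff_real_inner_le_zero hconv hp).1 (le_antisymm ?_ ?_)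
  · exact le_ciInf fun w => hmin w w.2
  · exact ciInf_le (f := fun w : Ω => ‖z - w‖)
      ⟨0, Set.forall_mem_range.2 fun _ => norm_nonneg _⟩ ⟨p, hp⟩

/-- Metric projection onto a convex set is nonexpansive. -/
lemma norm_nearest_sub_nearest_le (hconv : Convex ℝ Ω) {P : E → E}
    (hP : ∀ z, P z ∈ Ω ∧ ∀ w ∈ Ω, ‖z - P z‖ ≤ ‖z - w‖) (a b : E) :
    ‖P a - P b‖ ≤ ‖a - b‖ := by
  have ha := inner_sub_nearest_nonpos hconv (hP a).1 (hP a).2 (P b) (hP b).1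
  have hb := inner_sub_nearest_nonpos hconv (hP b).1 (hP b).2 (P a) (hP a).1
  have hfirm : ‖P a - P b‖ ^ 2 ≤ ⟪a - b, P a - P b⟫ := by
    rw [← real_inner_self_eq_norm_sq]
    simp only [inner_sub_left, inner_sub_right] at ha hb ⊢
    linarith
  have hcs := real_inner_le_norm (a - b) (P a - P b)
  by_contra! h
  nlinarith [norm_nonneg (a - b)]

end MetricProjection

/-- Strong monotonicity of the projected-gradient residual map: if `Ω ⊆ ℝⁿ` is nonempty,
closed and convex with metric projection `P`, `F` is `μ`-strongly monotone and
`κ`-Lipschitz on `Ω`, and `0 < α < 2μ/κ²`, then `H(x) = x − P(x − α F x)` is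
`ω₁`-strongly monotone on `Ω`, where `ω₁ = (2αμ − α²κ²)/(2 + ακ)`. -/
theorem projected_residual_strongly_monotone {n : ℕ}
    (Ω : Set (EuclideanSpace ℝ (Fin n)))
    (hne : Ω.Nonempty) (hclosed : IsClosed Ω) (hconv : Convex ℝ Ω)
    (P : EuclideanSpace ℝ (Fin n) → EuclideanSpace ℝ (Fin n))
    (hP : ∀ z, P z ∈ Ω ∧ ∀ w ∈ Ω, ‖z - P z‖ ≤ ‖z - w‖)
    (F : EuclideanSpace ℝ (Fin n) → EuclideanSpace ℝ (Fin n))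
    (μ κ : ℝ) (hμ : 0 < μ) (hκ : 0 < κ)
    (hmono : ∀ x ∈ Ω, ∀ y ∈ Ω, μ * ‖x - y‖ ^ 2 ≤ ⟪F x - F y, x - y⟫)
    (hlip : ∀ x ∈ Ω, ∀ y ∈ Ω, ‖F x - F y‖ ≤ κ * ‖x - y‖)
    (α : ℝ) (hα0 : 0 < α) (hα1 : α < 2 * μ / κ ^ 2) :
    ∀ x ∈ Ω, ∀ y ∈ Ω,
      (2 * α * μ - α ^ 2 * κ ^ 2) / (2 + α * κ) * ‖x - y‖ ^ 2 ≤
        ⟪x - y, (x - P (x - α • F x)) - (y - P (y - α • F y))⟫ := by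
  intro x hx y hy
  have hN : 0 < 2 * α * μ - α ^ 2 * κ ^ 2 := by
    rw [lt_div_iff₀ (by positivity)] at hα1
    nlinarith
  have hm := hmono x hx y hy
  have hl : ‖F x - F y‖ ^ 2 ≤ κ ^ 2 * ‖x - y‖ ^ 2 := by
    rw [← mul_pow]
    exact pow_le_pow_left₀ (norm_nonneg _) (hlip x hx y hy) 2
  have hp := norm_nearest_sub_nearest_le hconv hP (x - α • F x) (y - α • F y)
  set p := P (x - α • F x) - P (y - α • F y) with hpdef
  set u := (x - α • F x) - (y - α • F y) with hudef
  have hu : ‖u‖ ^ 2 = ‖x - y‖ ^ 2 - 2 * α * ⟪F x - F y, x - y⟫ + α ^ 2 * ‖F x - F y‖ ^ 2 := by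
    rw [show u = (x - y) - α • (F x - F y) by rw [hudef, smul_sub]; abel,
      norm_sub_sq_real, real_inner_smul_right, norm_smul, mul_pow, Real.norm_eq_abs, sq_abs,
      real_inner_comm]
    ring
  have hcontr : (2 * α * μ - α ^ 2 * κ ^ 2) * ‖x - y‖ ^ 2 ≤ ‖x - y‖ ^ 2 - ‖u‖ ^ 2 := by
    have h₁ := mul_le_mul_of_nonneg_left hm (by positivity : 0 ≤ 2 * α)
    have h₂ := mul_le_mul_of_nonneg_left hl (by positivity : 0 ≤ α ^ 2)
    linarith
  have hle : ‖u‖ ≤ ‖x - y‖ := by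
    refine (sq_le_sq₀ (norm_nonneg _) (norm_nonneg _)).1 ?_
    linarith [mul_nonneg hN.le (sq_nonneg ‖x - y‖)]
  have hinner : ‖x - y‖ * (‖x - y‖ - ‖u‖) ≤
      ⟪x - y, (x - P (x - α • F x)) - (y - P (y - α • F y))⟫ := by
    rw [show (x - P (x - α • F x)) - (y - P (y - α • F y)) = (x - y) - p by rw [hpdef]; abel,
      inner_sub_right, real_inner_self_eq_norm_sq]
    have hcs := real_inner_le_norm (x - y) p
    have h := mul_le_mul_of_nonneg_left hp (norm_nonneg (x - y))
    linarith
  refine le_trans ?_ hinner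
  rw [div_mul_eq_mul_div, div_le_iff₀ (by positivity)]
  have hsum : ‖x - y‖ + ‖u‖ ≤ (2 + α * κ) * ‖x - y‖ := by
    have : 0 ≤ α * κ * ‖x - y‖ := by positivity
    linarith
  have h := mul_le_mul_of_nonneg_left hsum (sub_nonneg.2 hle)
  linarith
end

section
/- Let a, b : [0,∞) → [0,∞) be functions, and let a₀, b₀ ≥ 0, ω₁, ω₂ > 0 and γ₁, γ₂ > 0 with γ₁·γ₂ < 1. Suppose that for all t ≥ 0: a(t) ≤ a₀·exp(−ω₁ t) + γ₁·sup_{0≤τ≤t} b(τ) and b(t) ≤ b₀·exp(−ω₂ t) + γ₂·sup_{0≤τ≤t} a(τ), where the suprema are assumed finite. Then for all t ≥ 0, sup_{0≤τ≤t} a(τ) ≤ (a₀ + γ₁ b₀)/(1 − γ₁γ₂) and sup_{0≤τ≤t} b(τ) ≤ (b₀ + γ₂ a₀)/(1 − γ₁γ₂). -/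
open Set

/-- A finite-gain estimate with decaying transient passes to the running suprema, the transient
being bounded by its initial amplitude. -/
theorem sSup_image_Icc_le_of_exp_gain {u v : ℝ → ℝ} {c ω γ : ℝ} (hc : 0 ≤ c) (hω : 0 ≤ ω)
    (hγ : 0 ≤ γ) (hvBdd : ∀ t : ℝ, 0 ≤ t → BddAbove (v '' Icc 0 t))
    (hu : ∀ t : ℝ, 0 ≤ t → u t ≤ c * Real.exp (-ω * t) + γ * sSup (v '' Icc 0 t))
    {t : ℝ} (ht : 0 ≤ t) :
    sSup (u '' Icc 0 t) ≤ c + γ * sSup (v '' Icc 0 t) := by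
  refine csSup_le ((nonempty_Icc.2 ht).image u) ?_
  rintro _ ⟨s, ⟨hs, hst⟩, rfl⟩
  have hexp : Real.exp (-ω * s) ≤ 1 := Real.exp_le_one_iff.2 (by nlinarith)
  have hsup : sSup (v '' Icc 0 s) ≤ sSup (v '' Icc 0 t) :=
    csSup_le_csSup (hvBdd t ht) ((nonempty_Icc.2 hs).image v)
      (image_mono (Icc_subset_Icc_right hst))
  exact (hu s hs).trans
    (add_le_add (mul_le_of_le_one_right hc hexp) (mul_le_mul_of_nonneg_left hsup hγ))

/-- The small-gain bound for two interconnected eISS estimates: if nonnegative signals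
`a, b : [0,∞) → [0,∞)` satisfy `a(t) ≤ a₀ e^{−ω₁ t} + γ₁ sup_{0≤τ≤t} b(τ)` and
`b(t) ≤ b₀ e^{−ω₂ t} + γ₂ sup_{0≤τ≤t} a(τ)` with finite running suprema, and the
small-gain condition `γ₁ γ₂ < 1` holds, then
`sup_{0≤τ≤t} a(τ) ≤ (a₀ + γ₁ b₀)/(1 − γ₁γ₂)` and
`sup_{0≤τ≤t} b(τ) ≤ (b₀ + γ₂ a₀)/(1 − γ₁γ₂)` for all `t ≥ 0`. -/
theorem small_gain_sup_bound
    (a b : ℝ → ℝ) (ha_nonneg : ∀ t : ℝ, 0 ≤ t → 0 ≤ a t)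
    (hb_nonneg : ∀ t : ℝ, 0 ≤ t → 0 ≤ b t)
    (a₀ b₀ : ℝ) (ha₀ : 0 ≤ a₀) (hb₀ : 0 ≤ b₀)
    (ω₁ ω₂ γ₁ γ₂ : ℝ) (hω₁ : 0 < ω₁) (hω₂ : 0 < ω₂) (hγ₁ : 0 < γ₁) (hγ₂ : 0 < γ₂)
    (hsg : γ₁ * γ₂ < 1)
    -- the running suprema are finite
    (haBdd : ∀ t : ℝ, 0 ≤ t → BddAbove (a '' Icc 0 t))
    (hbBdd : ∀ t : ℝ, 0 ≤ t → BddAbove (b '' Icc 0 t))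
    -- the two eISS estimates
    (ha : ∀ t : ℝ, 0 ≤ t →
      a t ≤ a₀ * Real.exp (-ω₁ * t) + γ₁ * sSup (b '' Icc 0 t))
    (hb : ∀ t : ℝ, 0 ≤ t →
      b t ≤ b₀ * Real.exp (-ω₂ * t) + γ₂ * sSup (a '' Icc 0 t)) :
    ∀ t : ℝ, 0 ≤ t →
      sSup (a '' Icc 0 t) ≤ (a₀ + γ₁ * b₀) / (1 - γ₁ * γ₂) ∧
        sSup (b '' Icc 0 t) ≤ (b₀ + γ₂ * a₀) / (1 - γ₁ * γ₂) := by
  intro t ht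
  have hA := sSup_image_Icc_le_of_exp_gain ha₀ hω₁.le hγ₁.le hbBdd ha ht
  have hB := sSup_image_Icc_le_of_exp_gain hb₀ hω₂.le hγ₂.le haBdd hb ht
  have hpos : 0 < 1 - γ₁ * γ₂ := sub_pos.2 hsg
  rw [le_div_iff₀ hpos, le_div_iff₀ hpos]
  constructor
  · linarith [mul_le_mul_of_nonneg_left hB hγ₁.le]
  · linarith [mul_le_mul_of_nonneg_left hA hγ₂.le]
end

section
/- Let a, b : [0,∞) → [0,∞) be bounded functions, and let ω₁, ω₂ > 0 and γ₁, γ₂ > 0 with γ₁·γ₂ < 1. Suppose the eISS estimates hold from every initial time: for all 0 ≤ s ≤ t, a(t) ≤ a(s)·exp(−ω₁(t − s)) + γ₁·sup_{s≤τ≤t} b(τ) and b(t) ≤ b(s)·exp(−ω₂(t − s)) + γ₂·sup_{s≤τ≤t} a(τ). Then a and b converge to zero exponentially: there exist constants C > 0 and ρ > 0, depending only on ω₁, ω₂, γ₁, γ₂, such that a(t) + b(t) ≤ C·(a(0) + b(0))·exp(−ρ t) for all t ≥ 0. -/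
open Set

/-- A gain estimate with a running supremum gives a bound by any constant dominating the input. -/
lemma le_decay_add_gain {a b : ℝ → ℝ} {ω γ s t N : ℝ} (hγ : 0 < γ) (hst : s ≤ t)
    (h : a t ≤ a s * Real.exp (-ω * (t - s)) + γ * sSup (b '' Icc s t))
    (hN : ∀ τ, s ≤ τ → b τ ≤ N) :
    a t ≤ a s * Real.exp (-ω * (t - s)) + γ * N := by
  have hsup : sSup (b '' Icc s t) ≤ N := by
    refine csSup_le ((nonempty_Icc.2 hst).image b) ?_
    rintro _ ⟨τ, hτ, rfl⟩
    exact hN τ hτ.1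
  have := mul_le_mul_of_nonneg_left hsup hγ.le
  linarith

/-- Uniform bound on the first of two bounded signals from the small-gain condition. -/
lemma small_gain_uniform_bound {a b : ℝ → ℝ} {ω₁ ω₂ γ₁ γ₂ : ℝ} (hω₁ : 0 < ω₁) (hω₂ : 0 < ω₂)
    (hγ₁ : 0 < γ₁) (hγ₂ : 0 < γ₂) (hsg : γ₁ * γ₂ < 1)
    (ha : ∀ t, 0 ≤ t → 0 ≤ a t) (hb : ∀ t, 0 ≤ t → 0 ≤ b t)
    (hA : BddAbove (a '' Ici 0)) (hB : BddAbove (b '' Ici 0))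
    (hab : ∀ s t : ℝ, 0 ≤ s → s ≤ t →
      a t ≤ a s * Real.exp (-ω₁ * (t - s)) + γ₁ * sSup (b '' Icc s t))
    (hba : ∀ s t : ℝ, 0 ≤ s → s ≤ t →
      b t ≤ b s * Real.exp (-ω₂ * (t - s)) + γ₂ * sSup (a '' Icc s t))
    (t : ℝ) (ht : 0 ≤ t) : a t ≤ (a 0 + γ₁ * b 0) / (1 - γ₁ * γ₂) := by
  have hne (f : ℝ → ℝ) : (f '' Ici 0).Nonempty := nonempty_Ici.image f
  have hleA : ∀ τ, 0 ≤ τ → a τ ≤ sSup (a '' Ici 0) :=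
    fun τ hτ => le_csSup hA (mem_image_of_mem a hτ)
  have hleB : ∀ τ, 0 ≤ τ → b τ ≤ sSup (b '' Ici 0) :=
    fun τ hτ => le_csSup hB (mem_image_of_mem b hτ)
  have hexp {ω τ : ℝ} (hω : 0 < ω) (hτ : 0 ≤ τ) : Real.exp (-ω * (τ - 0)) ≤ 1 :=
    Real.exp_le_one_iff.2 (by nlinarith)
  have hsupA : sSup (a '' Ici 0) ≤ a 0 + γ₁ * sSup (b '' Ici 0) := by
    refine csSup_le (hne a) ?_
    rintro _ ⟨τ, hτ, rfl⟩
    have h := le_decay_add_gain hγ₁ hτ (hab 0 τ le_rfl hτ) hleB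
    have := mul_le_of_le_one_right (ha 0 le_rfl) (hexp hω₁ hτ)
    linarith
  have hsupB : sSup (b '' Ici 0) ≤ b 0 + γ₂ * sSup (a '' Ici 0) := by
    refine csSup_le (hne b) ?_
    rintro _ ⟨τ, hτ, rfl⟩
    have h := le_decay_add_gain hγ₂ hτ (hba 0 τ le_rfl hτ) hleA
    have := mul_le_of_le_one_right (hb 0 le_rfl) (hexp hω₂ hτ)
    linarith
  refine (hleA t ht).trans ?_
  rw [le_div_iff₀ (by linarith)]
  have := mul_le_mul_of_nonneg_left hsupB hγ₁.le
  linarith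

/-- Geometric decay over time steps of length `T`, in coordinates scaled by `r` and `p`. -/
lemma small_gain_geometric_decay {a b : ℝ → ℝ} {ω₁ ω₂ p r T ε M : ℝ} (hω₁ : 0 < ω₁)
    (hω₂ : 0 < ω₂) (hp : 0 < p) (hr : 0 < r) (hT : 0 ≤ T) (hε : 0 ≤ ε) (hM : 0 ≤ M)
    (hε₁ : Real.exp (-ω₁ * T) ≤ ε) (hε₂ : Real.exp (-ω₂ * T) ≤ ε)
    (hab : ∀ s t : ℝ, 0 ≤ s → s ≤ t →
      a t ≤ a s * Real.exp (-ω₁ * (t - s)) + r ^ 2 * sSup (b '' Icc s t))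
    (hba : ∀ s t : ℝ, 0 ≤ s → s ≤ t →
      b t ≤ b s * Real.exp (-ω₂ * (t - s)) + p ^ 2 * sSup (a '' Icc s t))
    (haM : ∀ t, 0 ≤ t → a t ≤ r * M) (hbM : ∀ t, 0 ≤ t → b t ≤ p * M) (n : ℕ) :
    ∀ t, n * T ≤ t → a t ≤ r * ((ε + p * r) ^ n * M) ∧ b t ≤ p * ((ε + p * r) ^ n * M) := by
  induction n with
  | zero =>
    intro t ht
    simp only [Nat.cast_zero, zero_mul] at ht
    simpa using And.intro (haM t ht) (hbM t ht)
  | succ n ih =>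
    intro t ht
    push_cast at ht
    have hs : (0 : ℝ) ≤ n * T := by positivity
    have hst : n * T ≤ t := by linarith
    have hexp {ω : ℝ} (hω : 0 < ω) (h : Real.exp (-ω * T) ≤ ε) :
        Real.exp (-ω * (t - n * T)) ≤ ε :=
      (Real.exp_le_exp.2 (by nlinarith)).trans h
    have h₁ := le_decay_add_gain (by positivity) hst (hab _ t hs hst) fun τ hτ => (ih τ hτ).2
    have h₂ := le_decay_add_gain (by positivity) hst (hba _ t hs hst) fun τ hτ => (ih τ hτ).1
    have h₃ := mul_le_mul (ih _ le_rfl).1 (hexp hω₁ hε₁) (Real.exp_pos _).le (by positivity)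
    have h₄ := mul_le_mul (ih _ le_rfl).2 (hexp hω₂ hε₂) (Real.exp_pos _).le (by positivity)
    constructor
    · refine (h₁.trans (add_le_add_left h₃ _)).trans_eq ?_
      ring
    · refine (h₂.trans (add_le_add_left h₄ _)).trans_eq ?_
      ring

/-- A geometric sequence sampled at times `n T` is dominated by an exponential. -/
lemma pow_floor_div_le_exp {q : ℝ} (hq : 0 < q) (hq1 : q < 1) (T t : ℝ) :
    q ^ ⌊t / T⌋₊ ≤ q⁻¹ * Real.exp (-(-Real.log q / T) * t) := by
  have hlog := Real.log_neg hq hq1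
  have h : q ^ (⌊t / T⌋₊ + 1) ≤ Real.exp (-(-Real.log q / T) * t) := by
    rw [← Real.exp_log (pow_pos hq _), Real.log_pow, Real.exp_le_exp]
    have hfl := (Nat.lt_floor_add_one (t / T)).le
    push_cast
    calc _ ≤ t / T * Real.log q := mul_le_mul_of_nonpos_right hfl hlog.le
      _ = _ := by ring
  rw [pow_succ] at h
  rw [inv_mul_eq_div, le_div_iff₀ hq]
  exact h

/-- Small-gain theorem for two interconnected eISS systems: there exist constants
`C > 0` and `ρ > 0`, depending only on `ω₁, ω₂, γ₁, γ₂` with `γ₁γ₂ < 1`, such that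
any bounded nonnegative signals `a, b : [0,∞) → [0,∞)` satisfying the eISS estimates
from every initial time `s` — `a(t) ≤ a(s) e^{−ω₁(t−s)} + γ₁ sup_{s≤τ≤t} b(τ)` and
`b(t) ≤ b(s) e^{−ω₂(t−s)} + γ₂ sup_{s≤τ≤t} a(τ)` for `0 ≤ s ≤ t` — converge to zero
exponentially: `a(t) + b(t) ≤ C (a(0) + b(0)) e^{−ρ t}` for all `t ≥ 0`. -/
theorem small_gain_exponential_convergence
    (ω₁ ω₂ γ₁ γ₂ : ℝ) (hω₁ : 0 < ω₁) (hω₂ : 0 < ω₂) (hγ₁ : 0 < γ₁) (hγ₂ : 0 < γ₂)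
    (hsg : γ₁ * γ₂ < 1) :
    ∃ C : ℝ, 0 < C ∧ ∃ ρ : ℝ, 0 < ρ ∧
      ∀ a b : ℝ → ℝ,
        (∀ t : ℝ, 0 ≤ t → 0 ≤ a t) → (∀ t : ℝ, 0 ≤ t → 0 ≤ b t) →
        BddAbove (a '' Ici 0) → BddAbove (b '' Ici 0) →
        (∀ s t : ℝ, 0 ≤ s → s ≤ t →
          a t ≤ a s * Real.exp (-ω₁ * (t - s)) + γ₁ * sSup (b '' Icc s t)) →
        (∀ s t : ℝ, 0 ≤ s → s ≤ t →
          b t ≤ b s * Real.exp (-ω₂ * (t - s)) + γ₂ * sSup (a '' Icc s t)) →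
        ∀ t : ℝ, 0 ≤ t → a t + b t ≤ C * (a 0 + b 0) * Real.exp (-ρ * t) := by
  obtain ⟨r, hr, rfl⟩ : ∃ r : ℝ, 0 < r ∧ r ^ 2 = γ₁ :=
    ⟨√γ₁, Real.sqrt_pos.2 hγ₁, Real.sq_sqrt hγ₁.le⟩
  obtain ⟨p, hp, rfl⟩ : ∃ p : ℝ, 0 < p ∧ p ^ 2 = γ₂ :=
    ⟨√γ₂, Real.sqrt_pos.2 hγ₂, Real.sq_sqrt hγ₂.le⟩
  have hpr : 0 < p * r := mul_pos hp hr
  have hpr1 : p * r < 1 := by nlinarith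
  obtain ⟨ε, hε⟩ : ∃ ε, ε = (1 - p * r) / 2 := ⟨_, rfl⟩
  have hε0 : 0 < ε := by linarith
  have hq1 : ε + p * r < 1 := by linarith
  have hlogε : Real.log ε < 0 := Real.log_neg hε0 (by linarith)
  obtain ⟨T, hT⟩ : ∃ T, T = -Real.log ε / min ω₁ ω₂ := ⟨_, rfl⟩
  have hω : 0 < min ω₁ ω₂ := lt_min hω₁ hω₂
  have hT0 : 0 < T := hT ▸ div_pos (neg_pos.2 hlogε) hω
  have hωT : min ω₁ ω₂ * T = -Real.log ε := by rw [hT]; field_simp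
  have hexp {ω : ℝ} (h : min ω₁ ω₂ ≤ ω) : Real.exp (-ω * T) ≤ ε := by
    rw [← Real.le_log_iff_exp_le hε0]
    have := mul_le_mul_of_nonneg_right h hT0.le
    linarith
  have hd : 0 < 1 - r ^ 2 * p ^ 2 := by linarith
  obtain ⟨K, hK⟩ : ∃ K, K = (1 + r ^ 2 + p ^ 2) / (1 - r ^ 2 * p ^ 2) := ⟨_, rfl⟩
  have hK0 : 0 < K := by rw [hK]; positivity
  refine ⟨(r + p) * (ε + p * r)⁻¹ * (K * (r⁻¹ + p⁻¹)), by positivity,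
    -Real.log (ε + p * r) / T, div_pos (neg_pos.2 (Real.log_neg (by positivity) hq1)) hT0, ?_⟩
  intro a b ha hb hA hB hab hba t ht
  have ha0 := ha 0 le_rfl
  have hb0 := hb 0 le_rfl
  obtain ⟨M, hM⟩ : ∃ M, M = K * (r⁻¹ + p⁻¹) * (a 0 + b 0) := ⟨_, rfl⟩
  have hM0 : 0 ≤ M := by rw [hM]; positivity
  have haK : ∀ t, 0 ≤ t → a t ≤ K * (a 0 + b 0) := fun t ht => by
    refine (small_gain_uniform_bound hω₁ hω₂ hγ₁ hγ₂ hsg ha hb hA hB hab hba t ht).trans ?_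
    rw [hK, div_mul_eq_mul_div]
    gcongr
    nlinarith [mul_nonneg hγ₁.le ha0, mul_nonneg hγ₂.le ha0, mul_nonneg hγ₂.le hb0]
  have hbK : ∀ t, 0 ≤ t → b t ≤ K * (a 0 + b 0) := fun t ht => by
    refine (small_gain_uniform_bound hω₂ hω₁ hγ₂ hγ₁ (by linarith) hb ha hB hA hba hab t
      ht).trans ?_
    rw [hK, div_mul_eq_mul_div, mul_comm (p ^ 2) (r ^ 2)]
    gcongr
    nlinarith [mul_nonneg hγ₁.le ha0, mul_nonneg hγ₁.le hb0, mul_nonneg hγ₂.le hb0]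
  have hrM : K * (a 0 + b 0) ≤ r * M := by
    have : r * M = K * (a 0 + b 0) + r * p⁻¹ * (K * (a 0 + b 0)) := by
      rw [hM]; field_simp
    rw [this]
    exact le_add_of_nonneg_right (by positivity)
  have hpM : K * (a 0 + b 0) ≤ p * M := by
    have : p * M = K * (a 0 + b 0) + p * r⁻¹ * (K * (a 0 + b 0)) := by
      rw [hM]; field_simp; ring
    rw [this]
    exact le_add_of_nonneg_right (by positivity)
  have hfloor : (⌊t / T⌋₊ : ℝ) * T ≤ t :=
    (le_div_iff₀ hT0).1 (Nat.floor_le (div_nonneg ht hT0.le))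
  obtain ⟨h₁, h₂⟩ := small_gain_geometric_decay hω₁ hω₂ hp hr hT0.le hε0.le hM0
    (hexp (min_le_left _ _)) (hexp (min_le_right _ _)) hab hba
    (fun t ht => (haK t ht).trans hrM) (fun t ht => (hbK t ht).trans hpM) _ t hfloor
  have hpow := pow_floor_div_le_exp (by positivity) hq1 T t
  calc a t + b t ≤ (r + p) * M * (ε + p * r) ^ ⌊t / T⌋₊ := by linarith
    _ ≤ (r + p) * M * ((ε + p * r)⁻¹ * Real.exp (-(-Real.log (ε + p * r) / T) * t)) := by
      gcongr
    _ = _ := by rw [hM]; ring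
end
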